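/- Let d ≥ 1, θ ∈ [0, 1), and suppose K > 0 is a constant such that sup_{k∈ℤ^d} u(k)² ≤ K·‖u‖^{2θ}·‖∇u‖^{2(1−θ)} holds for all u ∈ l²(ℤ^d). Let u^{(1)}, …, u^{(N)} ∈ l²(ℤ^d) be orthonormal with respect to the l² scalar product, and set ρ(k) := ∑_{j=1}^N u^{(j)}(k)². Then ∑_{k∈ℤ^d} ρ(k)^{(2−θ)/(1−θ)} ≤ K^{1/(1−θ)}·∑_{j=1}^N ‖∇u^{(j)}‖². -/

import Mathlib

open Real

lemma summable_mul_of_summable_sq {α : Type*} {f g : α → ℝ}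
    (hf : Summable fun n => f n ^ 2) (hg : Summable fun n => g n ^ 2) :
    Summable fun n => f n * g n := by
  refine Summable.of_norm_bounded (hf.add hg) fun n => ?_
  rw [Real.norm_eq_abs, abs_le]
  constructor <;> nlinarith [sq_nonneg (f n + g n), sq_nonneg (f n - g n), sq_nonneg (f n),
    sq_nonneg (g n)]

lemma summable_sq_diff {G : Type*} [AddGroup G] {f : G → ℝ}
    (hf : Summable fun n => f n ^ 2) (e : G) :
    Summable fun n => (f (n + e) - f n) ^ 2 := by
  have hshift : Summable fun n => f (n + e) ^ 2 :=
    hf.comp_injective (add_left_injective e)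
  refine Summable.of_nonneg_of_le (fun n => sq_nonneg _) (fun n => ?_)
    ((hshift.add hf).mul_left 2)
  nlinarith [sq_nonneg (f (n + e) + f n)]

/-- The squared `l²` norm of a linear combination is the Gram quadratic form. -/
lemma hasSum_sq_linearCombination {α ι : Type*} [Fintype ι] {f : ι → α → ℝ}
    (hf : ∀ i, Summable fun n => f i n ^ 2) (c : ι → ℝ) :
    HasSum (fun n => (∑ i, c i * f i n) ^ 2)
      (∑ i, ∑ j, c i * c j * ∑' n, f i n * f j n) := by
  have h : HasSum (fun n => ∑ i, ∑ j, c i * c j * (f i n * f j n))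
      (∑ i, ∑ j, c i * c j * ∑' n, f i n * f j n) :=
    hasSum_sum fun i _ => hasSum_sum fun j _ =>
      ((summable_mul_of_summable_sq (hf i) (hf j)).hasSum).mul_left _
  refine h.congr_fun fun n => ?_
  rw [sq, Finset.sum_mul_sum]
  exact Finset.sum_congr rfl fun i _ => Finset.sum_congr rfl fun j _ => by ring

lemma rpow_le_of_sq_le_mul_rpow {θ K ρ E : ℝ} (hθ : θ < 1) (hK : 0 ≤ K) (hρ : 0 ≤ ρ)
    (hE : 0 ≤ E) (h : ρ ^ 2 ≤ K * ρ ^ θ * E ^ (1 - θ)) :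
    ρ ^ ((2 - θ) / (1 - θ)) ≤ K ^ (1 / (1 - θ)) * E := by
  have hθ' : 0 < 1 - θ := sub_pos.mpr hθ
  rcases hρ.eq_or_lt with rfl | hρ
  · rw [zero_rpow (div_pos (by linarith) hθ').ne']
    positivity
  have hle : ρ ^ (2 - θ) ≤ K * E ^ (1 - θ) := by
    rw [rpow_sub hρ, rpow_two, div_le_iff₀ (rpow_pos_of_pos hρ θ)]
    linarith
  calc ρ ^ ((2 - θ) / (1 - θ)) = (ρ ^ (2 - θ)) ^ (1 / (1 - θ)) := by
        rw [← rpow_mul hρ.le, mul_one_div]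
    _ ≤ (K * E ^ (1 - θ)) ^ (1 / (1 - θ)) :=
        rpow_le_rpow (by positivity) hle (by positivity)
    _ = K ^ (1 / (1 - θ)) * E := by
        rw [mul_rpow hK (by positivity), ← rpow_mul hE, mul_one_div_cancel hθ'.ne', rpow_one]

/-- Inequality for orthonormal families: if
`sup_k u(k)² ≤ K ‖u‖^{2θ} ‖∇u‖^{2(1-θ)}` holds on `l²(ℤ^d)` and
`u⁽¹⁾, …, u⁽ᴺ⁾` are orthonormal in `l²(ℤ^d)` with `ρ(k) = ∑_j u⁽ʲ⁾(k)²`, then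
`∑_k ρ(k)^{(2-θ)/(1-θ)} ≤ K^{1/(1-θ)} ∑_j ‖∇u⁽ʲ⁾‖²`. -/
theorem orthonormal_family_inequality (d N : ℕ) (hd : 1 ≤ d) (θ : ℝ)
    (hθ : θ ∈ Set.Ico (0 : ℝ) 1) (K : ℝ) (hK : 0 < K)
    (hineq : ∀ v : (Fin d → ℤ) → ℝ, Summable (fun n => v n ^ 2) →
      ∀ k : Fin d → ℤ, v k ^ 2 ≤ K * (∑' n : Fin d → ℤ, v n ^ 2) ^ θ *
        (∑' n : Fin d → ℤ, ∑ j, (v (n + Pi.single j 1) - v n) ^ 2) ^ (1 - θ))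
    (u : Fin N → (Fin d → ℤ) → ℝ)
    (hsum : ∀ j, Summable fun n => u j n ^ 2)
    (horth : ∀ i j, (∑' n : Fin d → ℤ, u i n * u j n) = if i = j then (1 : ℝ) else 0) :
    (∑' k : Fin d → ℤ, (∑ j, u j k ^ 2) ^ ((2 - θ) / (1 - θ))) ≤
      K ^ (1 / (1 - θ)) *
        ∑ j, ∑' n : Fin d → ℤ, ∑ i, (u j (n + Pi.single i 1) - u j n) ^ 2 := by
  set A : Fin N → Fin N → ℝ := fun i j => ∑ l : Fin d, ∑' n : Fin d → ℤ,
    (u i (n + Pi.single l 1) - u i n) * (u j (n + Pi.single l 1) - u j n) with hA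
  have hdiff : ∀ (l : Fin d) (j : Fin N),
      Summable fun n : Fin d → ℤ => (u j (n + Pi.single l 1) - u j n) ^ 2 :=
    fun l j => summable_sq_diff (hsum j) _
  have henergy : ∀ k : Fin d → ℤ,
      (∑' n : Fin d → ℤ, ∑ l, ((∑ j, u j k * u j (n + Pi.single l 1))
        - ∑ j, u j k * u j n) ^ 2) = ∑ i, ∑ j, u i k * u j k * A i j := by
    intro k
    have h := hasSum_sum (s := Finset.univ) fun l (_ : l ∈ Finset.univ) =>
      hasSum_sq_linearCombination (hdiff l) fun j => u j k
    simp only [mul_sub, Finset.sum_sub_distrib] at h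
    rw [h.tsum_eq, Finset.sum_comm]
    refine Finset.sum_congr rfl fun i _ => ?_
    rw [Finset.sum_comm]
    simp only [hA, Finset.mul_sum, mul_sub]
  have hnorm : ∀ k : Fin d → ℤ,
      (∑' n : Fin d → ℤ, (∑ j, u j k * u j n) ^ 2) = ∑ j, u j k ^ 2 := by
    intro k
    rw [(hasSum_sq_linearCombination hsum fun j => u j k).tsum_eq]
    simp [horth, sq]
  have hpoint : ∀ k : Fin d → ℤ, (∑ j, u j k ^ 2) ^ ((2 - θ) / (1 - θ)) ≤
      K ^ (1 / (1 - θ)) * ∑ i, ∑ j, u i k * u j k * A i j := by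
    intro k
    have h := hineq (fun n => ∑ j, u j k * u j n)
      (hasSum_sq_linearCombination hsum fun j => u j k).summable k
    rw [hnorm, henergy] at h
    refine rpow_le_of_sq_le_mul_rpow hθ.2 hK.le (Finset.sum_nonneg fun j _ => sq_nonneg _) ?_ ?_
    · rw [← henergy]
      exact tsum_nonneg fun n => Finset.sum_nonneg fun l _ => sq_nonneg _
    · simpa only [sq] using h
  have htrace : HasSum (fun k => ∑ i, ∑ j, u i k * u j k * A i j) (∑ j, A j j) := by
    have h := hasSum_sum (s := Finset.univ) fun i (_ : i ∈ Finset.univ) =>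
      hasSum_sum (s := Finset.univ) fun j (_ : j ∈ Finset.univ) =>
        ((summable_mul_of_summable_sq (hsum i) (hsum j)).hasSum).mul_right (A i j)
    simpa [horth] using h
  have hdiag : ∀ j, A j j =
      ∑' n : Fin d → ℤ, ∑ l, (u j (n + Pi.single l 1) - u j n) ^ 2 := by
    intro j
    rw [Summable.tsum_finsetSum fun l _ => hdiff l j]
    simp only [hA, sq]
  have hbound := htrace.mul_left (K ^ (1 / (1 - θ)))
  simp only [← hdiag]
  rw [← hbound.tsum_eq]
  refine Summable.tsum_le_tsum hpoint ?_ hbound.summable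
  exact hbound.summable.of_nonneg_of_le
    (fun k => rpow_nonneg (Finset.sum_nonneg fun j _ => sq_nonneg _) _) hpoint
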